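/- Let N ≥ 2 and let Γ = (Γ_T)_T be any consistent family of strategies. If θ ∈ (0,1)^N has a unique maximal coordinate θ_{i*} (so θ_i < θ_{i*} for some i), then there exist c > 0 and T_0 such that L(θ;Γ_T,T) ≥ c·ln T for all T ≥ T_0. Thus the loss of any consistent strategy grows at least logarithmically in the horizon. -/

import Mathlib

open MeasureTheory ProbabilityTheory Filter
open scoped BigOperators ENNReal

/-- A deterministic medium-access strategy: it maps the history of
(sensed channel, observed outcome) pairs to the channel to be sensed in the next slot. -/
def Strategy (N : ℕ) : Type := List (Fin N × Bool) → Fin N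

/-- The history of (channel, outcome) pairs accumulated after `j` (0-indexed) slots, given
the full availability table `ω` (`ω j i = true` iff channel `i` is free in slot `j`). -/
def Strategy.hist {N : ℕ} (Γ : Strategy N) (ω : ℕ → Fin N → Bool) :
    ℕ → List (Fin N × Bool)
  | 0 => []
  | j + 1 =>
    Strategy.hist Γ ω j ++
      [(Γ (Strategy.hist Γ ω j), ω j (Γ (Strategy.hist Γ ω j)))]

/-- The channel selected by strategy `Γ` at (0-indexed) slot `j`. -/
def Strategy.sel {N : ℕ} (Γ : Strategy N) (ω : ℕ → Fin N → Bool) (j : ℕ) : Fin N :=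
  Γ (Γ.hist ω j)

/-- Extension of a finite availability table to all time slots. -/
def extendOut {N T : ℕ} (ω : Fin T → Fin N → Bool) : ℕ → Fin N → Bool :=
  fun j i => if h : j < T then ω ⟨j, h⟩ i else false

/-- The probability of observing the availability table `ω` when each channel `i` is free
in each slot independently with probability `θ i`. -/
def outWt {N T : ℕ} (θ : Fin N → ℝ) (ω : Fin T → Fin N → Bool) : ℝ :=
  ∏ j : Fin T, ∏ i : Fin N, (if ω j i then θ i else 1 - θ i)

/-- `W B θ T Γ`: the expected number of bits transmitted over a block of `T` slots by the
cognitive user employing strategy `Γ`, when `B` bits are sent each time the sensed channel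
is free, i.e. `E_θ[∑_{j=1}^T B · Z_{S(j)}(j)]`. -/
noncomputable def W {N : ℕ} (B : ℝ) (θ : Fin N → ℝ) (T : ℕ) (Γ : Strategy N) : ℝ :=
  ∑ ω : Fin T → Fin N → Bool, outWt θ ω *
    ∑ j ∈ Finset.range T, (if extendOut ω j (Γ.sel (extendOut ω) j) then B else 0)

/-- `probSel θ T Γ j i`: the probability that strategy `Γ` selects channel `i` at
(0-indexed) slot `j`, under parameter `θ`. -/
noncomputable def probSel {N : ℕ} (θ : Fin N → ℝ) (T : ℕ) (Γ : Strategy N)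
    (j : ℕ) (i : Fin N) : ℝ :=
  ∑ ω : Fin T → Fin N → Bool, (if Γ.sel (extendOut ω) j = i then outWt θ ω else 0)

/-- `expY θ T Γ i`: the expected number of slots among the first `T` in which strategy `Γ`
senses channel `i`, i.e. `E_θ[Y_i(T)]`. -/
noncomputable def expY {N : ℕ} (θ : Fin N → ℝ) (T : ℕ) (Γ : Strategy N) (i : Fin N) : ℝ :=
  ∑ ω : Fin T → Fin N → Bool, outWt θ ω *
    (((Finset.range T).filter fun j => Γ.sel (extendOut ω) j = i).card : ℝ)

/-- The throughput loss of strategy `Γ` over a block of `T` slots, relative to always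
sensing a best channel `istar`: `L(θ;Γ,T) = T·B·θ_{i*} − W_Γ(θ,T)`. -/
noncomputable def Loss {N : ℕ} (B : ℝ) (θ : Fin N → ℝ) (istar : Fin N) (T : ℕ)
    (Γ : Strategy N) : ℝ :=
  T * B * θ istar - W B θ T Γ

/-- A family of strategies (one for each horizon `T`) is consistent if for every
`θ ∈ [0,1]^N` there are `β < 1` and `C > 0` with `L(θ;Γ_T,T) ≤ C·T^β` for all `T ≥ 1`. -/
def Consistent {N : ℕ} (B : ℝ) (Γ : ℕ → Strategy N) : Prop :=
  ∀ θ : Fin N → ℝ, (∀ i, θ i ∈ Set.Icc (0:ℝ) 1) →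
    ∀ istar : Fin N, (∀ k, θ k ≤ θ istar) →
      ∃ β C : ℝ, β < 1 ∧ 0 < C ∧
        ∀ T : ℕ, 1 ≤ T → Loss B θ istar T (Γ T) ≤ C * (T : ℝ) ^ β

/-- The Bayesian expected throughput of strategy `Γ` under prior `f`. -/
noncomputable def WBayes {N : ℕ} (B : ℝ) (T : ℕ) (Γ : Strategy N)
    (f : Measure (Fin N → ℝ)) : ℝ :=
  ∫ θ, W B θ T Γ ∂f

/-- The optimal Bayesian value `V*(f,T) = sup_Γ W_Γ(f,T)`. -/
noncomputable def Vstar {N : ℕ} (B : ℝ) (T : ℕ) (f : Measure (Fin N → ℝ)) : ℝ :=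
  ⨆ Γ : Strategy N, WBayes B T Γ f

/-- The Bayesian posterior after sensing channel `i` and observing outcome `z`:
`f_{z_i=1}` has density `θ_i / ∫θ_i f(dθ)` w.r.t. `f`, and `f_{z_i=0}` has density
`(1−θ_i) / ∫(1−θ_i) f(dθ)` w.r.t. `f`. -/
noncomputable def posterior {N : ℕ} (f : Measure (Fin N → ℝ)) (i : Fin N) (z : Bool) :
    Measure (Fin N → ℝ) :=
  if z then f.withDensity fun θ => ENNReal.ofReal (θ i / ∫ θ', θ' i ∂f)
  else f.withDensity fun θ => ENNReal.ofReal ((1 - θ i) / ∫ θ', (1 - θ' i) ∂f)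

/-- Kullback–Leibler divergence between Bernoulli(a) and Bernoulli(b). -/
noncomputable def klBernoulli (a b : ℝ) : ℝ :=
  a * Real.log (a / b) + (1 - a) * Real.log ((1 - a) / (1 - b))

lemma sum_prod_ite_mul {N : ℕ} (θ : Fin N → ℝ) (a : Fin N) (G : Bool → ℝ) :
    ∑ x : Fin N → Bool, (∏ i, (if x i then θ i else 1 - θ i)) * G (x a) =
      θ a * G true + (1 - θ a) * G false := by
  have h := Finset.prod_univ_sum (fun _ : Fin N => (Finset.univ : Finset Bool))
    (fun i b => (if b then θ i else 1 - θ i) * (if i = a then G b else 1))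
  rw [Fintype.piFinset_univ] at h
  simp only [Finset.prod_mul_distrib, Finset.prod_ite_eq', Finset.mem_univ, if_true] at h
  rw [← h, Finset.prod_eq_single a]
  · simp
  · intro b _ hb
    simp [hb]
  · simp

lemma hist_congr {N : ℕ} (Γ : Strategy N) {ω ω' : ℕ → Fin N → Bool} :
    ∀ {T : ℕ}, (∀ j < T, ω j = ω' j) → Γ.hist ω T = Γ.hist ω' T
  | 0, _ => rfl
  | T + 1, h => by
    have ih := hist_congr Γ (T := T) fun j hj => h j (Nat.lt_succ_of_lt hj)
    simp only [Strategy.hist, ih, h T (Nat.lt_succ_self T)]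

lemma length_hist {N : ℕ} (Γ : Strategy N) (ω : ℕ → Fin N → Bool) (T : ℕ) :
    (Γ.hist ω T).length = T := by
  induction T with
  | zero => rfl
  | succ T ih => simp [Strategy.hist, ih]

lemma outWt_nonneg {N T : ℕ} {θ : Fin N → ℝ} (hθ : ∀ i, θ i ∈ Set.Icc (0 : ℝ) 1)
    (ω : Fin T → Fin N → Bool) : 0 ≤ outWt θ ω := by
  refine Finset.prod_nonneg fun j _ => Finset.prod_nonneg fun i _ => ?_
  split_ifs
  · exact (hθ i).1
  · exact sub_nonneg.2 (hθ i).2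

/-- The expectation of `g` evaluated at the history after `T` slots. -/
noncomputable def histExp {N : ℕ} (Γ : Strategy N) (θ : Fin N → ℝ) (T : ℕ)
    (g : List (Fin N × Bool) → ℝ) : ℝ :=
  ∑ ω : Fin T → Fin N → Bool, outWt θ ω * g (Γ.hist (extendOut ω) T)

/-- The conditional expectation of `g` at the next history, given the current one. -/
def histStep {N : ℕ} (Γ : Strategy N) (θ : Fin N → ℝ) (g : List (Fin N × Bool) → ℝ)
    (h : List (Fin N × Bool)) : ℝ :=
  θ (Γ h) * g (h ++ [(Γ h, true)]) + (1 - θ (Γ h)) * g (h ++ [(Γ h, false)])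

lemma histExp_zero {N : ℕ} (Γ : Strategy N) (θ : Fin N → ℝ) (g : List (Fin N × Bool) → ℝ) :
    histExp Γ θ 0 g = g [] := by
  simp [histExp, outWt, Strategy.hist]

lemma histExp_succ {N : ℕ} (Γ : Strategy N) (θ : Fin N → ℝ) (T : ℕ)
    (g : List (Fin N × Bool) → ℝ) :
    histExp Γ θ (T + 1) g = histExp Γ θ T (histStep Γ θ g) := by
  unfold histExp
  rw [← (Fin.snocEquiv fun _ : Fin (T + 1) => Fin N → Bool).sum_comp,
    Fintype.sum_prod_type_right]
  refine Finset.sum_congr rfl fun ω _ => ?_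
  rw [histStep, ← sum_prod_ite_mul θ _ fun b => g (Γ.hist (extendOut ω) T ++
    [(Γ (Γ.hist (extendOut ω) T), b)]), Finset.mul_sum]
  refine Finset.sum_congr rfl fun x _ => ?_
  have hω : Γ.hist (extendOut (Fin.snoc (α := fun _ => Fin N → Bool) ω x)) T =
      Γ.hist (extendOut ω) T := by
    refine hist_congr Γ fun j hj => ?_
    funext i
    simp [extendOut, hj, hj.trans (Nat.lt_succ_self T), Fin.snoc]
  have hx : extendOut (Fin.snoc (α := fun _ => Fin N → Bool) ω x) T = x := by
    funext i
    simp [extendOut, Fin.snoc]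
  rw [← mul_assoc]
  simp only [Fin.snocEquiv, Equiv.coe_fn_mk, Strategy.hist, hω, hx]
  simp [outWt, Fin.prod_univ_castSucc]

lemma histExp_mono {N : ℕ} (Γ : Strategy N) {θ : Fin N → ℝ}
    (hθ : ∀ i, θ i ∈ Set.Icc (0 : ℝ) 1) {T : ℕ} {g g' : List (Fin N × Bool) → ℝ}
    (h : ∀ l, l.length = T → g l ≤ g' l) : histExp Γ θ T g ≤ histExp Γ θ T g' :=
  Finset.sum_le_sum fun ω _ =>
    mul_le_mul_of_nonneg_left (h _ (length_hist Γ _ T)) (outWt_nonneg hθ ω)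

lemma histExp_add {N : ℕ} (Γ : Strategy N) (θ : Fin N → ℝ) (T : ℕ)
    (g g' : List (Fin N × Bool) → ℝ) :
    histExp Γ θ T (fun l => g l + g' l) = histExp Γ θ T g + histExp Γ θ T g' := by
  simp only [histExp, mul_add, Finset.sum_add_distrib]

lemma histExp_const_mul {N : ℕ} (Γ : Strategy N) (θ : Fin N → ℝ) (T : ℕ) (c : ℝ)
    (g : List (Fin N × Bool) → ℝ) :
    histExp Γ θ T (fun l => c * g l) = c * histExp Γ θ T g := by
  simp only [histExp, Finset.mul_sum]
  exact Finset.sum_congr rfl fun ω _ => by ring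

lemma histExp_const {N : ℕ} (Γ : Strategy N) (θ : Fin N → ℝ) (T : ℕ) (c : ℝ) :
    histExp Γ θ T (fun _ => c) = c := by
  induction T with
  | zero => rw [histExp_zero]
  | succ T ih =>
    rw [histExp_succ]
    convert ih using 2
    funext l
    simp only [histStep]
    ring

lemma loss_eq_histExp {N : ℕ} (B : ℝ) (θ : Fin N → ℝ) (istar : Fin N) (T : ℕ)
    (Γ : Strategy N) :
    Loss B θ istar T Γ =
      B * histExp Γ θ T (fun l => (l.map fun p => θ istar - θ p.1).sum) := by
  have hW : W B θ T Γ =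
      B * histExp Γ θ T (fun l => (l.map fun p => if p.2 then (1 : ℝ) else 0).sum) := by
    rw [← histExp_const_mul]
    refine Finset.sum_congr rfl fun ω _ => ?_
    congr 1
    have key : ∀ (ω : ℕ → Fin N → Bool) (n : ℕ),
        ∑ j ∈ Finset.range n, (if ω j (Γ.sel ω j) then B else 0) =
        B * ((Γ.hist ω n).map fun p => if p.2 then (1 : ℝ) else 0).sum := by
      intro ω n
      induction n with
      | zero => simp [Strategy.hist]
      | succ n ih =>
        rw [Finset.sum_range_succ, ih]
        simp only [Strategy.hist, List.map_append, List.sum_append, List.map_cons,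
          List.map_nil, List.sum_singleton, Strategy.sel, mul_add, mul_ite, mul_one, mul_zero]
        congr
    exact key _ T
  have hE : histExp Γ θ T (fun l => (l.map fun p => if p.2 then (1 : ℝ) else 0).sum) +
      histExp Γ θ T (fun l => (l.map fun p => θ istar - θ p.1).sum) = T * θ istar := by
    rw [← histExp_add]
    clear hW
    induction T with
    | zero => simp [histExp_zero]
    | succ T ih =>
      have hstep : histStep Γ θ (fun l => (l.map fun p => if p.2 then (1 : ℝ) else 0).sum +
          (l.map fun p => θ istar - θ p.1).sum) =
          fun l => ((l.map fun p => if p.2 then (1 : ℝ) else 0).sum +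
            (l.map fun p => θ istar - θ p.1).sum) + θ istar := by
        funext l
        simp only [histStep, List.map_append, List.sum_append, List.map_cons, List.map_nil,
          List.sum_singleton, if_true, Bool.false_eq_true, if_false]
        ring
      rw [histExp_succ, hstep, histExp_add, ih, histExp_const]
      push_cast
      ring
  rw [Loss, hW]
  linear_combination (-B) * hE

/-- The number of slots of a history in which channel `k` was sensed. -/
def senseCount {N : ℕ} (k : Fin N) (l : List (Fin N × Bool)) : ℕ :=
  l.countP fun p => p.1 = k

lemma senseCount_append {N : ℕ} (k a : Fin N) (b : Bool) (l : List (Fin N × Bool)) :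
    senseCount k (l ++ [(a, b)]) = senseCount k l + if a = k then 1 else 0 := by
  simp [senseCount, List.countP_append, List.countP_cons]

/-- Change of measure between parameters that differ only at channel `k`, with likelihood
ratio bounded below by `m`. -/
lemma histExp_pow_senseCount_mul_le {N : ℕ} (Γ : Strategy N) {θ θ' : Fin N → ℝ}
    (hθ : ∀ i, θ i ∈ Set.Icc (0 : ℝ) 1) (k : Fin N) {m : ℝ} (hm : 0 ≤ m)
    (hne : ∀ i, i ≠ k → θ' i = θ i) (h1 : m * θ k ≤ θ' k) (h0 : m * (1 - θ k) ≤ 1 - θ' k)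
    (T : ℕ) {g : List (Fin N × Bool) → ℝ} (hg : ∀ l, 0 ≤ g l) :
    histExp Γ θ T (fun l => m ^ senseCount k l * g l) ≤ histExp Γ θ' T g := by
  have hθ' : ∀ i, 0 ≤ θ' i ∧ 0 ≤ 1 - θ' i := by
    intro i
    have h2 := hθ i
    by_cases hi : i = k
    · subst hi
      exact ⟨(mul_nonneg hm h2.1).trans h1, (mul_nonneg hm (sub_nonneg.2 h2.2)).trans h0⟩
    · rw [hne i hi]
      exact ⟨h2.1, sub_nonneg.2 h2.2⟩
  induction T generalizing g with
  | zero => simp [histExp_zero, senseCount]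
  | succ T ih =>
    rw [histExp_succ, histExp_succ]
    refine le_trans (histExp_mono Γ hθ fun l _ => ?_) (ih (g := histStep Γ θ' g) fun l => ?_)
    · simp only [histStep, senseCount_append]
      have hp : 0 ≤ m ^ senseCount k l := pow_nonneg hm _
      have ha := mul_nonneg hp (hg (l ++ [(Γ l, true)]))
      have hb := mul_nonneg hp (hg (l ++ [(Γ l, false)]))
      by_cases hk : Γ l = k
      · rw [hk] at ha hb ⊢
        rw [if_pos rfl, pow_succ]
        nlinarith [mul_le_mul_of_nonneg_right h1 ha, mul_le_mul_of_nonneg_right h0 hb]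
      · rw [if_neg hk, hne _ hk, add_zero]
        exact le_of_eq (by ring)
    · exact add_nonneg (mul_nonneg (hθ' _).1 (hg _)) (mul_nonneg (hθ' _).2 (hg _))

lemma mul_senseCount_le_sum {N : ℕ} {f : Fin N → ℝ} (hf : ∀ i, 0 ≤ f i) (k : Fin N)
    (l : List (Fin N × Bool)) : f k * senseCount k l ≤ (l.map fun p => f p.1).sum := by
  induction l with
  | nil => simp [senseCount]
  | cons p l ih =>
    have hp := hf p.1
    by_cases h : p.1 = k
    · simp only [senseCount, List.countP_cons, h, decide_true, if_true, List.map_cons,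
        List.sum_cons] at ih ⊢
      push_cast
      linarith
    · simp only [senseCount, List.countP_cons, h, decide_false, List.map_cons,
        List.sum_cons, Bool.false_eq_true, if_false, add_zero] at ih ⊢
      linarith

lemma mul_length_sub_senseCount_le_sum {N : ℕ} {f : Fin N → ℝ} {d : ℝ} (k : Fin N)
    (hk : 0 ≤ f k) (hf : ∀ i, i ≠ k → d ≤ f i) (l : List (Fin N × Bool)) :
    d * (l.length - senseCount k l) ≤ (l.map fun p => f p.1).sum := by
  induction l with
  | nil => simp [senseCount]
  | cons p l ih =>
    by_cases h : p.1 = k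
    · simp only [senseCount, List.countP_cons, h, decide_true, if_true, List.map_cons,
        List.sum_cons, List.length_cons] at ih ⊢
      push_cast
      linarith
    · have := hf _ h
      simp only [senseCount, List.countP_cons, h, decide_false, List.map_cons,
        List.sum_cons, Bool.false_eq_true, if_false, add_zero, List.length_cons] at ih ⊢
      push_cast
      linarith

/-- The parameter-free core: if channel `k` is suboptimal under `θ` and best by a margin `d`
under `θ'`, small loss under `θ'` forces a loss of order `x` under `θ`. -/
lemma loss_lower_bound_of_loss {N : ℕ} {B : ℝ} (hB : 0 < B) (Γ : Strategy N)
    {θ θ' : Fin N → ℝ} (hθ : ∀ i, θ i ∈ Set.Icc (0 : ℝ) 1)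
    (hθ' : ∀ i, θ' i ∈ Set.Icc (0 : ℝ) 1) {istar k : Fin N} (hmax : ∀ i, θ i ≤ θ istar)
    (hne : ∀ i, i ≠ k → θ' i = θ i) {m d : ℝ} (hm : 0 < m) (hm1 : m ≤ 1)
    (h1 : m * θ k ≤ θ' k) (h0 : m * (1 - θ k) ≤ 1 - θ' k) (hd : 0 ≤ d)
    (hgap : ∀ i, i ≠ k → d ≤ θ' k - θ' i) (T : ℕ) {x : ℝ} (hx : 0 ≤ x) (hxT : x ≤ T / 2)
    (hloss : Loss B θ' k T Γ ≤ B * (d * (T / 2)) * (m ^ x / 2)) (hT : 0 < d * (T / 2)) :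
    B * (θ istar - θ k) * (x / 2) ≤ Loss B θ istar T Γ := by
  set g : List (Fin N × Bool) → ℝ := fun l => if (senseCount k l : ℝ) ≤ x then 1 else 0
  have hg : ∀ l, 0 ≤ g l := fun l => by
    simp only [g]
    split_ifs <;> norm_num
  have hmx : 0 < m ^ x := Real.rpow_pos_of_pos hm x
  have hθ'g : histExp Γ θ' T g ≤ m ^ x / 2 := by
    have h : d * (T / 2) * histExp Γ θ' T g ≤
        histExp Γ θ' T (fun l => (l.map fun p => θ' k - θ' p.1).sum) := by
      rw [← histExp_const_mul]
      refine histExp_mono Γ hθ' fun l hl => ?_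
      have hsum := mul_length_sub_senseCount_le_sum (f := fun i => θ' k - θ' i) k
        (by simp) hgap l
      rw [hl] at hsum
      have hnn : 0 ≤ (l.map fun p => θ' k - θ' p.1).sum := by
        refine List.sum_nonneg fun y hy => ?_
        obtain ⟨p, -, rfl⟩ := List.mem_map.1 hy
        by_cases hp : p.1 = k
        · simp [hp]
        · exact hd.trans (hgap _ hp)
      simp only [g]
      split_ifs with hY
      · refine le_trans ?_ hsum
        rw [mul_one]
        exact mul_le_mul_of_nonneg_left (by linarith) hd
      · simpa using hnn
    rw [loss_eq_histExp, mul_assoc] at hloss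
    have := h.trans (le_of_mul_le_mul_left hloss hB)
    exact le_of_mul_le_mul_left this hT
  have hθg : histExp Γ θ T g ≤ 1 / 2 := by
    have h : m ^ x * histExp Γ θ T g ≤ m ^ x / 2 := by
      refine le_trans ?_ ((histExp_pow_senseCount_mul_le Γ hθ k hm.le hne h1 h0 T hg).trans hθ'g)
      rw [← histExp_const_mul]
      refine histExp_mono Γ hθ fun l _ => ?_
      simp only [g]
      split_ifs with hY
      · rw [mul_one, mul_one, ← Real.rpow_natCast]
        exact Real.rpow_le_rpow_of_exponent_ge hm hm1 hY
      · simp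
    refine le_of_mul_le_mul_left (h.trans_eq ?_) hmx
    ring
  have hY : x / 2 ≤ histExp Γ θ T (fun l => (senseCount k l : ℝ)) := by
    have h : x ≤ histExp Γ θ T (fun l => (senseCount k l : ℝ)) + x * histExp Γ θ T g := by
      rw [← histExp_const_mul, ← histExp_add, ← histExp_const Γ θ T x]
      refine histExp_mono Γ hθ fun l _ => ?_
      rw [histExp_const]
      simp only [g]
      split_ifs with hY
      · simp
      · linarith [not_le.1 hY]
    nlinarith
  rw [loss_eq_histExp, mul_assoc]
  refine mul_le_mul_of_nonneg_left ?_ hB.le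
  refine (mul_le_mul_of_nonneg_left hY (sub_nonneg.2 (hmax k))).trans ?_
  rw [← histExp_const_mul]
  exact histExp_mono Γ hθ fun l _ =>
    mul_senseCount_le_sum (f := fun i => θ istar - θ i) (fun i => sub_nonneg.2 (hmax i)) k l

/-- With `c` small, `m ^ (c log T)` decays slower than `T ^ (β - 1)`. -/
lemma exists_log_threshold {m β : ℝ} (hm : 0 < m) (hm1 : m < 1) (hβ : β < 1) {C K : ℝ}
    (hK : 0 < K) :
    ∃ c : ℝ, 0 < c ∧ ∃ T₀ : ℕ, ∀ T : ℕ, T₀ ≤ T → 1 ≤ T ∧ c * Real.log T ≤ T / 2 ∧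
      C * (T : ℝ) ^ β ≤ K * T * m ^ (c * Real.log T) := by
  have hlm : Real.log m < 0 := Real.log_neg hm hm1
  set c : ℝ := (β - 1) / 2 / Real.log m with hc
  have hc0 : 0 < c := div_pos_of_neg_of_neg (by linarith) hlm
  refine ⟨c, hc0, ?_⟩
  have e1 : ∀ᶠ T : ℕ in atTop, c * Real.log T ≤ (T : ℝ) / 2 := by
    have h := (Real.isLittleO_log_id_atTop.comp_tendsto tendsto_natCast_atTop_atTop).bound
      (show (0 : ℝ) < 1 / (2 * c) by positivity)
    filter_upwards [h] with T hT
    simp only [Function.comp, id, Real.norm_eq_abs, Nat.abs_cast] at hT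
    have h2 := mul_le_mul_of_nonneg_left ((le_abs_self _).trans hT) hc0.le
    refine h2.trans_eq ?_
    field_simp
  have e2 : ∀ᶠ T : ℕ in atTop, C / K ≤ (T : ℝ) ^ ((1 - β) / 2) :=
    ((tendsto_rpow_atTop (by linarith)).comp tendsto_natCast_atTop_atTop).eventually_ge_atTop _
  obtain ⟨T₀, hT₀⟩ := eventually_atTop.1 (e1.and (e2.and (eventually_ge_atTop 1)))
  refine ⟨T₀, fun T hT => ?_⟩
  obtain ⟨h1, h2, h3⟩ := hT₀ T hT
  refine ⟨h3, h1, ?_⟩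
  have hTpos : (0 : ℝ) < T := by exact_mod_cast h3
  have hpow : m ^ (c * Real.log T) = (T : ℝ) ^ ((β - 1) / 2) := by
    rw [Real.rpow_def_of_pos hm, Real.rpow_def_of_pos hTpos, hc]
    congr 1
    field_simp [hlm.ne]
  rw [div_le_iff₀ hK] at h2
  have h4 := mul_le_mul_of_nonneg_right h2 (Real.rpow_nonneg hTpos.le β)
  refine h4.trans_eq ?_
  rw [hpow]
  have h5 : (T : ℝ) * (T : ℝ) ^ ((β - 1) / 2) = (T : ℝ) ^ ((1 - β) / 2) * (T : ℝ) ^ β := by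
    nth_rewrite 1 [← Real.rpow_one (T : ℝ)]
    rw [← Real.rpow_add hTpos, ← Real.rpow_add hTpos]
    congr 1
    ring
  linear_combination (-K) * h5

/-- For `N ≥ 2` and any consistent family of strategies `(Γ_T)_T`: if
`θ ∈ (0,1)^N` has a unique maximal coordinate `θ_{i*}`, then there exist `c > 0` and `T₀`
with `L(θ;Γ_T,T) ≥ c·ln T` for all `T ≥ T₀`; the loss of any consistent strategy grows
at least logarithmically in the horizon. -/
theorem consistent_loss_log_lower_bound {N : ℕ} (hN : 2 ≤ N) (B : ℝ) (hB : 0 < B)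
    (Γ : ℕ → Strategy N) (hcons : Consistent B Γ)
    (θ : Fin N → ℝ) (hθ : ∀ i, θ i ∈ Set.Ioo (0:ℝ) 1)
    (istar : Fin N) (hmax : ∀ i, i ≠ istar → θ i < θ istar) :
    ∃ c : ℝ, 0 < c ∧ ∃ T₀ : ℕ, ∀ T : ℕ, T₀ ≤ T →
      c * Real.log T ≤ Loss B θ istar T (Γ T) := by
  obtain ⟨k, hk⟩ : ∃ k : Fin N, k ≠ istar :=
    have : Nontrivial (Fin N) := Fin.nontrivial_iff_two_le.2 hN
    exists_ne istar
  have hki := hmax k hk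
  have hk01 := hθ k
  have hi01 := hθ istar
  have hle : ∀ i, θ i ≤ θ istar := fun i => by
    by_cases h : i = istar
    · rw [h]
    · exact (hmax i h).le
  have hIcc : ∀ i, θ i ∈ Set.Icc (0 : ℝ) 1 := fun i => Set.Ioo_subset_Icc_self (hθ i)
  set v : ℝ := (1 + θ istar) / 2 with hv
  have hv1 : v < 1 := by linarith [hi01.2]
  have hvi : θ istar < v := by linarith [hi01.2]
  set θ' : Fin N → ℝ := Function.update θ k v with hθ'
  have hθ'k : θ' k = v := Function.update_self ..
  have hne : ∀ i, i ≠ k → θ' i = θ i := fun i hi => Function.update_of_ne hi ..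
  have hIcc' : ∀ i, θ' i ∈ Set.Icc (0 : ℝ) 1 := fun i => by
    by_cases h : i = k
    · rw [h, hθ'k]
      exact ⟨by linarith [hi01.1], hv1.le⟩
    · rw [hne i h]
      exact hIcc i
  have hgap : ∀ i, i ≠ k → v - θ istar ≤ θ' k - θ' i := fun i hi => by
    rw [hθ'k, hne i hi]
    linarith [hle i]
  have hmax' : ∀ i, θ' i ≤ θ' k := fun i => by
    by_cases h : i = k
    · rw [h]
    · linarith [hgap i h]
  obtain ⟨β, C, hβ, -, hC⟩ := hcons θ' hIcc' k hmax'
  have hk1 : 0 < 1 - θ k := by linarith [hk01.2]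
  set m : ℝ := (1 - v) / (1 - θ k) with hm
  have hm0 : 0 < m := div_pos (by linarith) hk1
  have hm1 : m < 1 := (div_lt_one hk1).2 (by linarith)
  have hd : 0 < v - θ istar := by linarith
  obtain ⟨c, hc, T₀, hT₀⟩ := exists_log_threshold (C := C) hm0 hm1 hβ
    (show 0 < B * (v - θ istar) / 4 by positivity)
  refine ⟨B * (θ istar - θ k) * (c / 2), ?_, T₀, fun T hT => ?_⟩
  · have : 0 < θ istar - θ k := by linarith
    positivity
  obtain ⟨hT1, hxT, hCT⟩ := hT₀ T hT
  have hTpos : (0 : ℝ) < T := by exact_mod_cast hT1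
  have hx : 0 ≤ c * Real.log T := mul_nonneg hc.le (Real.log_natCast_nonneg T)
  refine le_trans (le_of_eq (by ring)) (loss_lower_bound_of_loss hB (Γ T) hIcc hIcc' hle hne
    hm0 hm1.le ?_ ?_ hd.le hgap T hx hxT ?_ (by positivity))
  · rw [hθ'k]
    nlinarith [hk01.1]
  · rw [hθ'k, hm, div_mul_cancel₀ _ hk1.ne']
  · refine ((hC T hT1).trans hCT).trans_eq ?_
    ring
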